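/- Let L > 0 and let w = (w₁,w₂) : ℝ² → ℝ² be a smooth L-periodic divergence-free vector field. Then −∫_{[0,L]²} (∂_{yy} Δ w₁)(Δ w₁) dx − ∫_{[0,L]²} (∂_{xx} Δ w₂)(Δ w₂) dx = ∫_{[0,L]²} (∂_y Δ w₁)² dx + ∫_{[0,L]²} (∂_x Δ w₂)² dx ≥ (1/2) ∫_{[0,L]²} (|∇ Δ w₁|² + |∇ Δ w₂|²) dx. -/

import Mathlib

open MeasureTheory Real Filter

noncomputable def pdX (f : ℝ × ℝ → ℝ) : ℝ × ℝ → ℝ := fun p => fderiv ℝ f p (1, 0)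

noncomputable def pdY (f : ℝ × ℝ → ℝ) : ℝ × ℝ → ℝ := fun p => fderiv ℝ f p (0, 1)

noncomputable def lap (f : ℝ × ℝ → ℝ) : ℝ × ℝ → ℝ := fun p => pdX (pdX f) p + pdY (pdY f) p

/-- `f` is `L`-periodic in each coordinate. -/
def IsPeriodicL (L : ℝ) (f : ℝ × ℝ → ℝ) : Prop :=
  (∀ p : ℝ × ℝ, f (p.1 + L, p.2) = f p) ∧ (∀ p : ℝ × ℝ, f (p.1, p.2 + L) = f p)

/-- The fundamental square `[0,L] × [0,L]`. -/
def Torus (L : ℝ) : Set (ℝ × ℝ) := Set.Icc (0:ℝ) L ×ˢ Set.Icc (0:ℝ) L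

theorem ContDiff.fderiv_apply_const {f : ℝ × ℝ → ℝ} (hf : ContDiff ℝ (⊤ : ℕ∞) f) (v : ℝ × ℝ) :
    ContDiff ℝ (⊤ : ℕ∞) (fun p => fderiv ℝ f p v) :=
  (hf.fderiv_right (m := ((⊤ : ℕ∞) : WithTop ℕ∞)) (by exact_mod_cast le_top)).clm_apply
    contDiff_const

theorem ContDiff.pdX {f : ℝ × ℝ → ℝ} (hf : ContDiff ℝ (⊤ : ℕ∞) f) :
    ContDiff ℝ (⊤ : ℕ∞) (pdX f) := hf.fderiv_apply_const _

theorem ContDiff.pdY {f : ℝ × ℝ → ℝ} (hf : ContDiff ℝ (⊤ : ℕ∞) f) :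
    ContDiff ℝ (⊤ : ℕ∞) (pdY f) := hf.fderiv_apply_const _

theorem ContDiff.lap {f : ℝ × ℝ → ℝ} (hf : ContDiff ℝ (⊤ : ℕ∞) f) :
    ContDiff ℝ (⊤ : ℕ∞) (lap f) := hf.pdX.pdX.add hf.pdY.pdY

theorem ContDiff.differentiable_of_smooth {f : ℝ × ℝ → ℝ} (hf : ContDiff ℝ (⊤ : ℕ∞) f) :
    Differentiable ℝ f := hf.differentiable (by simp)

theorem fderiv_add_right_of_periodic {f : ℝ × ℝ → ℝ} {a : ℝ × ℝ} (h : ∀ p, f (p + a) = f p)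
    (p : ℝ × ℝ) : fderiv ℝ f (p + a) = fderiv ℝ f p := by
  rw [← fderiv_comp_add_right, funext h]

theorem isPeriodicL_iff {L : ℝ} {f : ℝ × ℝ → ℝ} :
    IsPeriodicL L f ↔ (∀ p, f (p + (L, 0)) = f p) ∧ ∀ p, f (p + (0, L)) = f p := by
  simp [IsPeriodicL]

namespace IsPeriodicL

variable {L : ℝ} {f g : ℝ × ℝ → ℝ}

theorem fderiv_apply (hf : IsPeriodicL L f) (v : ℝ × ℝ) :
    IsPeriodicL L (fun p => fderiv ℝ f p v) := by
  rw [isPeriodicL_iff] at hf ⊢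
  exact ⟨fun p => by rw [fderiv_add_right_of_periodic hf.1],
    fun p => by rw [fderiv_add_right_of_periodic hf.2]⟩

theorem pdX (hf : IsPeriodicL L f) : IsPeriodicL L (pdX f) := hf.fderiv_apply _

theorem pdY (hf : IsPeriodicL L f) : IsPeriodicL L (pdY f) := hf.fderiv_apply _

theorem lap (hf : IsPeriodicL L f) : IsPeriodicL L (lap f) :=
  ⟨fun p => congrArg₂ (· + ·) (hf.pdX.pdX.1 p) (hf.pdY.pdY.1 p),
    fun p => congrArg₂ (· + ·) (hf.pdX.pdX.2 p) (hf.pdY.pdY.2 p)⟩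

theorem mul (hf : IsPeriodicL L f) (hg : IsPeriodicL L g) : IsPeriodicL L (fun p => f p * g p) :=
  ⟨fun p => congrArg₂ (· * ·) (hf.1 p) (hg.1 p), fun p => congrArg₂ (· * ·) (hf.2 p) (hg.2 p)⟩

end IsPeriodicL

theorem Continuous.integrableOn_torus {f : ℝ × ℝ → ℝ} (hf : Continuous f) (L : ℝ) :
    IntegrableOn f (Torus L) :=
  hf.continuousOn.integrableOn_compact (isCompact_Icc.prod isCompact_Icc)

theorem setIntegral_Icc_eq_zero_of_hasDerivAt {F F' : ℝ → ℝ} {L : ℝ} (hL : 0 ≤ L)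
    (hF : ∀ x, HasDerivAt F (F' x) x) (hF' : Continuous F') (h : F L = F 0) :
    ∫ x in Set.Icc 0 L, F' x = 0 := by
  rw [integral_Icc_eq_integral_Ioc, ← intervalIntegral.integral_of_le hL,
    intervalIntegral.integral_eq_sub_of_hasDerivAt (fun x _ => hF x)
      (hF'.intervalIntegrable _ _), h, sub_self]

theorem setIntegral_torus_pdX_eq_zero {L : ℝ} (hL : 0 ≤ L) {f : ℝ × ℝ → ℝ}
    (hf : ContDiff ℝ (⊤ : ℕ∞) f) (hp : IsPeriodicL L f) : ∫ p in Torus L, pdX f p = 0 := by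
  have hi := hf.pdX.continuous.integrableOn_torus L
  rw [Torus, Measure.volume_eq_prod] at hi ⊢
  rw [← Measure.prod_restrict, integral_prod_symm _ (by rwa [Measure.prod_restrict])]
  refine integral_eq_zero_of_ae (.of_forall fun y => ?_)
  refine setIntegral_Icc_eq_zero_of_hasDerivAt (F := fun x => f (x, y)) hL (fun x => ?_)
    (hf.pdX.continuous.comp (by fun_prop)) (by simpa using hp.1 (0, y))
  exact (hf.differentiable_of_smooth (x, y)).hasFDerivAt.comp_hasDerivAt x
    ((hasDerivAt_id x).prodMk (hasDerivAt_const x y))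

theorem setIntegral_torus_pdY_eq_zero {L : ℝ} (hL : 0 ≤ L) {f : ℝ × ℝ → ℝ}
    (hf : ContDiff ℝ (⊤ : ℕ∞) f) (hp : IsPeriodicL L f) : ∫ p in Torus L, pdY f p = 0 := by
  have hi := hf.pdY.continuous.integrableOn_torus L
  rw [Torus, Measure.volume_eq_prod] at hi ⊢
  rw [← Measure.prod_restrict, integral_prod _ (by rwa [Measure.prod_restrict])]
  refine integral_eq_zero_of_ae (.of_forall fun x => ?_)
  refine setIntegral_Icc_eq_zero_of_hasDerivAt (F := fun y => f (x, y)) hL (fun y => ?_)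
    (hf.pdY.continuous.comp (by fun_prop)) (by simpa using hp.2 (x, 0))
  exact (hf.differentiable_of_smooth (x, y)).hasFDerivAt.comp_hasDerivAt y
    ((hasDerivAt_const y x).prodMk (hasDerivAt_id y))

theorem fderiv_fun_mul_apply {f g : ℝ × ℝ → ℝ} (hf : Differentiable ℝ f) (hg : Differentiable ℝ g)
    (p v : ℝ × ℝ) :
    fderiv ℝ (fun q => f q * g q) p v = fderiv ℝ f p v * g p + f p * fderiv ℝ g p v := by
  rw [fderiv_fun_mul (hf p) (hg p)]
  simp
  ring

section IntegrationByParts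

variable {L : ℝ} {f g : ℝ × ℝ → ℝ}

theorem setIntegral_torus_pdX_mul (hL : 0 ≤ L)
    (hf : ContDiff ℝ (⊤ : ℕ∞) f) (hg : ContDiff ℝ (⊤ : ℕ∞) g)
    (hpf : IsPeriodicL L f) (hpg : IsPeriodicL L g) :
    ∫ p in Torus L, pdX f p * g p = -∫ p in Torus L, f p * pdX g p := by
  rw [eq_neg_iff_add_eq_zero, ← integral_add
    ((hf.pdX.mul hg).continuous.integrableOn_torus L)
    ((hf.mul hg.pdX).continuous.integrableOn_torus L),
    ← setIntegral_torus_pdX_eq_zero hL (hf.mul hg) (hpf.mul hpg)]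
  exact integral_congr_ae (.of_forall fun p => (fderiv_fun_mul_apply
    hf.differentiable_of_smooth hg.differentiable_of_smooth p _).symm)

theorem setIntegral_torus_pdY_mul (hL : 0 ≤ L)
    (hf : ContDiff ℝ (⊤ : ℕ∞) f) (hg : ContDiff ℝ (⊤ : ℕ∞) g)
    (hpf : IsPeriodicL L f) (hpg : IsPeriodicL L g) :
    ∫ p in Torus L, pdY f p * g p = -∫ p in Torus L, f p * pdY g p := by
  rw [eq_neg_iff_add_eq_zero, ← integral_add
    ((hf.pdY.mul hg).continuous.integrableOn_torus L)
    ((hf.mul hg.pdY).continuous.integrableOn_torus L),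
    ← setIntegral_torus_pdY_eq_zero hL (hf.mul hg) (hpf.mul hpg)]
  exact integral_congr_ae (.of_forall fun p => (fderiv_fun_mul_apply
    hf.differentiable_of_smooth hg.differentiable_of_smooth p _).symm)

end IntegrationByParts

section Commutation

variable {f : ℝ × ℝ → ℝ}

theorem pdX_pdY_comm (hf : ContDiff ℝ (⊤ : ℕ∞) f) : pdX (pdY f) = pdY (pdX f) := by
  funext p
  have hd : DifferentiableAt ℝ (fderiv ℝ f) p :=
    (hf.fderiv_right (m := ((⊤ : ℕ∞) : WithTop ℕ∞)) (by exact_mod_cast le_top)).differentiable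
      (by simp) p
  have hs : IsSymmSndFDerivAt ℝ f p :=
    hf.contDiffAt.isSymmSndFDerivAt (by
      rw [minSmoothness_of_isRCLikeNormedField]
      exact WithTop.coe_le_coe.2 le_top)
  have h (v w : ℝ × ℝ) :
      fderiv ℝ (fun q => fderiv ℝ f q v) p w = fderiv ℝ (fderiv ℝ f) p w v := by
    rw [fderiv_clm_apply hd (differentiableAt_const v)]
    simp
  exact (h _ _).trans ((hs.eq _ _).trans (h _ _).symm)

theorem pdX_lap (hf : ContDiff ℝ (⊤ : ℕ∞) f) : pdX (lap f) = lap (pdX f) := by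
  have h : pdX (lap f) = fun p => pdX (pdX (pdX f)) p + pdX (pdY (pdY f)) p := by
    funext p
    exact congrArg (· (1, 0)) (fderiv_fun_add (hf.pdX.pdX.differentiable_of_smooth p)
      (hf.pdY.pdY.differentiable_of_smooth p))
  rw [h, pdX_pdY_comm hf.pdY, pdX_pdY_comm hf]
  rfl

theorem pdY_lap (hf : ContDiff ℝ (⊤ : ℕ∞) f) : pdY (lap f) = lap (pdY f) := by
  have h : pdY (lap f) = fun p => pdY (pdX (pdX f)) p + pdY (pdY (pdY f)) p := by
    funext p
    exact congrArg (· (0, 1)) (fderiv_fun_add (hf.pdX.pdX.differentiable_of_smooth p)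
      (hf.pdY.pdY.differentiable_of_smooth p))
  rw [h, ← pdX_pdY_comm hf.pdX, ← pdX_pdY_comm hf]
  rfl

end Commutation

theorem pdX_neg (f : ℝ × ℝ → ℝ) : pdX (fun p => -f p) = fun p => -pdX f p := by
  funext p
  simp [pdX, fderiv_fun_neg]

theorem pdY_neg (f : ℝ × ℝ → ℝ) : pdY (fun p => -f p) = fun p => -pdY f p := by
  funext p
  simp [pdY, fderiv_fun_neg]

theorem lap_neg (f : ℝ × ℝ → ℝ) : lap (fun p => -f p) = fun p => -lap f p := by
  funext p
  simp only [lap, pdX_neg, pdY_neg]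
  ring

theorem pdX_lap_eq_neg_pdY_lap {w₁ w₂ : ℝ × ℝ → ℝ}
    (hw₁ : ContDiff ℝ (⊤ : ℕ∞) w₁) (hw₂ : ContDiff ℝ (⊤ : ℕ∞) w₂)
    (hdiv : ∀ p, pdX w₁ p + pdY w₂ p = 0) (p : ℝ × ℝ) :
    pdX (lap w₁) p = -pdY (lap w₂) p := by
  have h : pdX w₁ = fun q => -pdY w₂ q := funext fun q => eq_neg_of_add_eq_zero_left (hdiv q)
  rw [pdX_lap hw₁, h, lap_neg, pdY_lap hw₂]

theorem setIntegral_torus_pdX_mul_pdY {L : ℝ} (hL : 0 ≤ L) {u v : ℝ × ℝ → ℝ}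
    (hu : ContDiff ℝ (⊤ : ℕ∞) u) (hv : ContDiff ℝ (⊤ : ℕ∞) v)
    (hpu : IsPeriodicL L u) (hpv : IsPeriodicL L v) :
    ∫ p in Torus L, pdX u p * pdY v p = ∫ p in Torus L, pdY u p * pdX v p := by
  rw [setIntegral_torus_pdX_mul hL hu hv.pdY hpu hpv.pdY,
    setIntegral_torus_pdY_mul hL hu hv.pdX hpu hpv.pdX, pdX_pdY_comm hv]

/-- First-order anisotropic coercivity for a smooth periodic divergence-free field `(u, v)`. -/
theorem setIntegral_torus_gradient_sq_le {L : ℝ} (hL : 0 ≤ L) {u v : ℝ × ℝ → ℝ}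
    (hu : ContDiff ℝ (⊤ : ℕ∞) u) (hv : ContDiff ℝ (⊤ : ℕ∞) v)
    (hpu : IsPeriodicL L u) (hpv : IsPeriodicL L v)
    (hdiv : ∀ p, pdX u p = -pdY v p) :
    (1/2) * (∫ p in Torus L, ((pdX u p)^2 + (pdY u p)^2 + (pdX v p)^2 + (pdY v p)^2)) ≤
      (∫ p in Torus L, (pdY u p)^2) + ∫ p in Torus L, (pdX v p)^2 := by
  have cX := hu.pdX.continuous
  have cY := hu.pdY.continuous
  have dX := hv.pdX.continuous
  have dY := hv.pdY.continuous
  have key := setIntegral_torus_pdX_mul_pdY hL hu hv hpu hpv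
  rw [← sub_eq_zero, ← integral_sub (Continuous.integrableOn_torus (by fun_prop) L)
    (Continuous.integrableOn_torus (by fun_prop) L)] at key
  rw [← integral_add (Continuous.integrableOn_torus (by fun_prop) L)
      (Continuous.integrableOn_torus (by fun_prop) L),
    ← integral_const_mul, ← add_zero (∫ p in Torus L, 1 / 2 * _), ← key,
    ← integral_add]
  · refine integral_mono (Continuous.integrableOn_torus (by fun_prop) L)
      (Continuous.integrableOn_torus (by fun_prop) L) fun p => ?_
    simp only [hdiv p]
    nlinarith [sq_nonneg (pdY u p + pdX v p)]
  all_goals exact Continuous.integrableOn_torus (by fun_prop) L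

/-- Third-order anisotropic coercivity: for a smooth `L`-periodic divergence-free
vector field `w = (w₁,w₂)`,
`−∫ (∂_{yy}Δw₁)(Δw₁) − ∫ (∂_{xx}Δw₂)(Δw₂) = ∫ (∂_yΔw₁)² + ∫ (∂ₓΔw₂)²
  ≥ (1/2) ∫ (|∇Δw₁|² + |∇Δw₂|²)`. -/
theorem aniso_coercivity_third_order (L : ℝ) (hL : 0 < L)
    (w₁ w₂ : ℝ × ℝ → ℝ)
    (hsw₁ : ContDiff ℝ (⊤ : ℕ∞) w₁) (hsw₂ : ContDiff ℝ (⊤ : ℕ∞) w₂)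
    (hpw₁ : IsPeriodicL L w₁) (hpw₂ : IsPeriodicL L w₂)
    (hdiv : ∀ p : ℝ × ℝ, pdX w₁ p + pdY w₂ p = 0) :
    (-(∫ p in Torus L, (pdY (pdY (lap w₁)) p) * (lap w₁ p)) -
        (∫ p in Torus L, (pdX (pdX (lap w₂)) p) * (lap w₂ p)) =
      (∫ p in Torus L, (pdY (lap w₁) p)^2) +
        ∫ p in Torus L, (pdX (lap w₂) p)^2) ∧
    (1/2) * (∫ p in Torus L,
        ((pdX (lap w₁) p)^2 + (pdY (lap w₁) p)^2 +
          (pdX (lap w₂) p)^2 + (pdY (lap w₂) p)^2)) ≤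
      (∫ p in Torus L, (pdY (lap w₁) p)^2) +
        ∫ p in Torus L, (pdX (lap w₂) p)^2 := by
  have hu := hsw₁.lap
  have hv := hsw₂.lap
  have hpu := hpw₁.lap
  have hpv := hpw₂.lap
  refine ⟨?_, setIntegral_torus_gradient_sq_le hL.le hu hv hpu hpv
    (pdX_lap_eq_neg_pdY_lap hsw₁ hsw₂ hdiv)⟩
  rw [setIntegral_torus_pdY_mul hL.le hu.pdY hu hpu.pdY hpu,
    setIntegral_torus_pdX_mul hL.le hv.pdX hv hpv.pdX hpv]
  simp only [neg_neg, sub_neg_eq_add, sq]
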